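/- arXiv:2003.04837 — 9 statements merged into one kernel-verified Lean document; each statement's English description precedes it below -/
import Mathlib

section
/- Let J be the 4×4 Jacobian matrix of G at the equilibrium q(x₁), and set λ₁ = c p x₁/(α f₂) − b. Then for every real λ, det(J − λ·I) = λ(λ − λ₁)(λ² + bλ + cp(x₂ + βx₁)), where x₂ = bf₂/(cp) − x₁. -/
/-- The vector field of the viral evolution model on the 2-node
cross-immunoreactivity network with one directed edge from node 1 (persistent)
to node 2 (neutral), in the variables `(x₁, x₂, r₁, r₂) = (v 0, v 1, v 2, v 3)`. -/
noncomputable def G (p c b f₁ f₂ α β : ℝ) (v : Fin 4 → ℝ) : Fin 4 → ℝ :=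
  ![f₁ * v 0 - p * v 0 * (v 2 + β * v 3),
    f₂ * v 1 - p * v 1 * v 3,
    c * v 0 * v 2 / (v 2 + α * v 3) - b * v 2,
    c * (α * v 0 * v 3 / (v 2 + α * v 3) + v 1) - b * v 3]

/-- The one-parameter family of local-immunodeficiency equilibria `q(x₁)`. -/
noncomputable def qTwo (p c b f₂ : ℝ) (x₁ : ℝ) : Fin 4 → ℝ :=
  ![x₁, b * f₂ / (c * p) - x₁, 0, f₂ / p]

/-- The Jacobian matrix (matrix of partial derivatives) of a vector field at a point. -/
noncomputable def jacobianMat {ι : Type*} [Fintype ι] [DecidableEq ι]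
    (H : (ι → ℝ) → ι → ℝ) (y : ι → ℝ) : Matrix ι ι ℝ :=
  Matrix.of fun i j => fderiv ℝ (fun v => H v i) y (Pi.single j 1)

/-- With `λ₁ = cpx₁/(αf₂) − b` and `x₂ = bf₂/(cp) − x₁`, for every real `λ` the
characteristic determinant of the Jacobian `J` of `G` at `q(x₁)` factors as
`det(J − λI) = λ(λ − λ₁)(λ² + bλ + cp(x₂ + βx₁))`. -/
theorem stmt7 (p c b f₁ f₂ α β : ℝ)
    (hp : 0 < p) (hc : 0 < c) (hb : 0 < b) (hf₁ : 0 < f₁) (hf₂ : 0 < f₂)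
    (hβ : 0 < β) (hβα : β < α) (hα : α < 1)
    (hf : f₁ = β * f₂)
    (x₁ : ℝ) (hx₁ : 0 < x₁) (hx₁' : x₁ < b * f₂ / (c * p)) :
    ∀ lam : ℝ,
      (jacobianMat (G p c b f₁ f₂ α β) (qTwo p c b f₂ x₁)
          - lam • (1 : Matrix (Fin 4) (Fin 4) ℝ)).det =
        lam * (lam - (c * p * x₁ / (α * f₂) - b)) *
          (lam ^ 2 + b * lam + c * p * ((b * f₂ / (c * p) - x₁) + β * x₁)) := by
  intro lam
  have hα0 : 0 < α := hβ.trans hβα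
  have hp' := hp.ne'
  have hc' := hc.ne'
  have hα' := hα0.ne'
  have hf₂' := hf₂.ne'
  set y := qTwo p c b f₂ x₁ with hy
  have y0 : y 0 = x₁ := by simp [hy, qTwo]
  have y1 : y 1 = b * f₂ / (c * p) - x₁ := by simp [hy, qTwo]
  have y2 : y 2 = 0 := by simp [hy, qTwo]
  have y3 : y 3 = f₂ / p := by simp [hy, qTwo]
  have hd : y 2 + α * y 3 ≠ 0 := by
    rw [y2, y3]; positivity
  have P : ∀ i : Fin 4, HasFDerivAt (fun v : Fin 4 → ℝ => v i)
      (ContinuousLinearMap.proj (R := ℝ) (φ := fun _ : Fin 4 => ℝ) i) y :=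
    fun i => hasFDerivAt_apply i y
  have hD := (P 2).add ((P 3).const_mul α)
  have hI := (hasDerivAt_inv hd).comp_hasFDerivAt y hD
  have F0 := ((P 0).const_mul f₁).sub
    (((P 0).const_mul p).mul ((P 2).add ((P 3).const_mul β)))
  have F1 := ((P 1).const_mul f₂).sub (((P 1).const_mul p).mul (P 3))
  have F2 := ((((P 0).const_mul c).mul (P 2)).mul hI).sub ((P 2).const_mul b)
  have F3 := ((((((P 0).const_mul α).mul (P 3)).mul hI).add (P 1)).const_mul c).sub
    ((P 3).const_mul b)
  have E0 : fderiv ℝ (fun v => G p c b f₁ f₂ α β v 0) y = _ := F0.fderiv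
  have E1 : fderiv ℝ (fun v => G p c b f₁ f₂ α β v 1) y = _ := F1.fderiv
  have E2 : fderiv ℝ (fun v => G p c b f₁ f₂ α β v 2) y = _ :=
    (congrArg (fun g => fderiv ℝ g y) (by
      funext v; simp [G, div_eq_mul_inv])).trans F2.fderiv
  have E3 : fderiv ℝ (fun v => G p c b f₁ f₂ α β v 3) y = _ :=
    (congrArg (fun g => fderiv ℝ g y) (by
      funext v; simp [G, div_eq_mul_inv])).trans F3.fderiv
  have hJ : jacobianMat (G p c b f₁ f₂ α β) y =
      !![0, 0, -(p * x₁), -(p * β * x₁);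
         0, 0, 0, -(p * (b * f₂ / (c * p) - x₁));
         0, 0, c * p * x₁ / (α * f₂) - b, 0;
         c, c, -(c * p * x₁ / (α * f₂)), -b] := by
    ext i j
    fin_cases i <;> simp only [jacobianMat, Matrix.of_apply, Fin.zero_eta, Fin.mk_one,
      Fin.reduceFinMk, E0, E1, E2, E3] <;> fin_cases j <;>
      simp [y0, y1, y2, y3, hf] <;> field_simp <;> ring
  rw [hJ]
  simp [Matrix.det_succ_row_zero, Fin.sum_univ_succ, Fin.succAbove, Matrix.one_apply]
  field_simp
  ring
end

section
/- For every x₁ with 0 < x₁ < bf₂/(cp), the Jacobian matrix J of G at the equilibrium q(x₁) is singular: det J = 0, i.e. 0 is an eigenvalue of J. Consequently no equilibrium of this family is linearly (asymptotically) stable; it can at best be marginally stable. -/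
/-- For every `0 < x₁ < bf₂/(cp)`, the Jacobian `J` of `G` at the equilibrium
`q(x₁)` is singular: `det J = 0`, i.e. `0` is an eigenvalue of `J` (a root of
its characteristic polynomial). Consequently no equilibrium of this family is
linearly (asymptotically) stable; it can at best be marginally stable. -/
theorem stmt8 (p c b f₁ f₂ α β : ℝ)
    (hp : 0 < p) (hc : 0 < c) (hb : 0 < b) (hf₁ : 0 < f₁) (hf₂ : 0 < f₂)
    (hβ : 0 < β) (hβα : β < α) (hα : α < 1)
    (hf : f₁ = β * f₂)
    (x₁ : ℝ) (hx₁ : 0 < x₁) (hx₁' : x₁ < b * f₂ / (c * p)) :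
    (jacobianMat (G p c b f₁ f₂ α β) (qTwo p c b f₂ x₁)).det = 0 ∧
    (Matrix.charpoly (jacobianMat (G p c b f₁ f₂ α β) (qTwo p c b f₂ x₁))).IsRoot 0 := by
  have hd : f₂ / p ≠ 0 := by positivity
  have hα0 : 0 < α := hβ.trans hβα
  have hdiff : ∀ i, DifferentiableAt ℝ (fun v => G p c b f₁ f₂ α β v i) (qTwo p c b f₂ x₁) := by
    have hne : (qTwo p c b f₂ x₁) 2 + α * (qTwo p c b f₂ x₁) 3 ≠ 0 := by
      simp [qTwo]
      exact ⟨hα0.ne', hf₂.ne', hp.ne'⟩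
    intro i
    fin_cases i <;> simp [G] <;> fun_prop (disch := assumption)
  have hline : ∀ i, fderiv ℝ (fun v => G p c b f₁ f₂ α β v i) (qTwo p c b f₂ x₁)
      (Pi.single 0 1 - Pi.single 1 1) = 0 := by
    intro i
    have h1 := (hdiff i).hasFDerivAt.hasLineDerivAt
      (Pi.single (0 : Fin 4) (1 : ℝ) - Pi.single 1 1)
    have h2 : (fun t : ℝ => G p c b f₁ f₂ α β (qTwo p c b f₂ x₁ +
        t • (Pi.single (0 : Fin 4) (1 : ℝ) - Pi.single 1 1)) i) = fun _ => 0 := by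
      funext t
      subst hf
      fin_cases i <;> simp [G, qTwo, Pi.single_apply] <;> field_simp <;> ring
    unfold HasLineDerivAt at h1
    rw [h2] at h1
    exact h1.unique (hasDerivAt_const _ _)
  have hdet : (jacobianMat (G p c b f₁ f₂ α β) (qTwo p c b f₂ x₁)).det = 0 := by
    rw [← Matrix.exists_mulVec_eq_zero_iff]
    refine ⟨![1, -1, 0, 0], fun h => by simpa using congrFun h 0, ?_⟩
    funext i
    have := hline i
    rw [map_sub] at this
    simp only [Matrix.mulVec, dotProduct, Fin.sum_univ_four, jacobianMat, Matrix.of_apply]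
    simp
    linarith
  refine ⟨hdet, ?_⟩
  rw [Polynomial.IsRoot, Matrix.eval_charpoly]
  simp [Matrix.det_neg, hdet]
end

section
/- If α b f₂/(cp) < x₁ < b f₂/(cp), then the Jacobian matrix J of G at q(x₁) has a strictly positive real eigenvalue, namely λ₁ = c p x₁/(α f₂) − b > 0; hence the equilibrium q(x₁) is linearly unstable. -/
/-- If `αbf₂/(cp) < x₁ < bf₂/(cp)`, then the Jacobian `J` of `G` at `q(x₁)` has
a strictly positive real eigenvalue, namely `λ₁ = cpx₁/(αf₂) − b > 0`; hence
the equilibrium `q(x₁)` is linearly unstable. -/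
theorem stmt9 (p c b f₁ f₂ α β : ℝ)
    (hp : 0 < p) (hc : 0 < c) (hb : 0 < b) (hf₁ : 0 < f₁) (hf₂ : 0 < f₂)
    (hβ : 0 < β) (hβα : β < α) (hα : α < 1)
    (hf : f₁ = β * f₂)
    (x₁ : ℝ) (hlo : α * b * f₂ / (c * p) < x₁) (hhi : x₁ < b * f₂ / (c * p)) :
    0 < c * p * x₁ / (α * f₂) - b ∧
    (Matrix.charpoly (jacobianMat (G p c b f₁ f₂ α β) (qTwo p c b f₂ x₁))).IsRoot
      (c * p * x₁ / (α * f₂) - b) := by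
  have hα0 : 0 < α := hβ.trans hβα
  constructor
  · rw [div_lt_iff₀ (by positivity)] at hlo
    rw [sub_pos, lt_div_iff₀ (by positivity)]
    nlinarith
  · rw [Polynomial.IsRoot.def, Matrix.eval_charpoly]
    apply Matrix.det_eq_zero_of_row_eq_zero 2
    intro j
    set q := qTwo p c b f₂ x₁ with hq
    have q0 : q 0 = x₁ := by simp [hq, qTwo]
    have q2 : q 2 = 0 := by simp [hq, qTwo]
    have q3 : q 3 = f₂ / p := by simp [hq, qTwo]
    have hfun : (fun v : Fin 4 → ℝ => G p c b f₁ f₂ α β v 2)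
        = fun v => v 2 * (c * v 0 / (v 2 + α * v 3) - b) := by
      funext v
      simp only [G, Matrix.cons_val]
      ring
    have hne : q 2 + α * q 3 ≠ 0 := by
      rw [q2, q3]; positivity
    have hg : DifferentiableAt ℝ (fun v : Fin 4 → ℝ => c * v 0 / (v 2 + α * v 3) - b) q := by
      fun_prop (disch := assumption)
    have h2 : HasFDerivAt (fun v : Fin 4 → ℝ => v 2)
        (ContinuousLinearMap.proj (R := ℝ) (φ := fun _ : Fin 4 => ℝ) 2) q :=
      hasFDerivAt_apply 2 q
    have hval : c * q 0 / (q 2 + α * q 3) - b = c * p * x₁ / (α * f₂) - b := by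
      rw [q0, q2, q3]; field_simp; simp
    have hd := (h2.mul hg.hasFDerivAt).fderiv
    have hJ : jacobianMat (G p c b f₁ f₂ α β) q 2 j
        = (c * p * x₁ / (α * f₂) - b) * (Pi.single j 1 : Fin 4 → ℝ) 2 := by
      simp only [jacobianMat, Matrix.of_apply]
      rw [hfun]
      erw [hd]
      simp [q2, ← hval]
    rw [Matrix.sub_apply, hJ]
    fin_cases j <;> simp [Matrix.scalar_apply]
end

section
/- If 0 < x₁ < α b f₂/(cp), then every complex root λ of the characteristic polynomial of the Jacobian matrix J of G at q(x₁) satisfies either λ = 0 or Re(λ) < 0. In particular the equilibrium q(x₁) is marginally stable: all eigenvalues other than the single zero eigenvalue lie in the open left half-plane. -/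
lemma jac_eq (p c b f₁ f₂ α β x₁ : ℝ) (hp : 0 < p) (hf₂ : 0 < f₂) (hα : 0 < α)
    (hf : f₁ = β * f₂) :
    jacobianMat (G p c b f₁ f₂ α β) (qTwo p c b f₂ x₁) =
      !![0, 0, -(p * x₁), -(p * β * x₁);
         0, 0, 0, -(p * (b * f₂ / (c * p) - x₁));
         0, 0, c * x₁ / (α * (f₂ / p)) - b, 0;
         c, c, -(c * x₁ / (α * (f₂ / p))), -b] := by
  set q := qTwo p c b f₂ x₁ with hq
  have h0 : q 0 = x₁ := by simp [hq, qTwo]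
  have h1 : q 1 = b * f₂ / (c * p) - x₁ := by simp [hq, qTwo]
  have h2 : q 2 = 0 := by simp [hq, qTwo]
  have h3 : q 3 = f₂ / p := by simp [hq, qTwo]
  have P (i : Fin 4) : HasFDerivAt (fun v : Fin 4 → ℝ => v i)
      (ContinuousLinearMap.proj (R := ℝ) (φ := fun _ : Fin 4 => ℝ) i) q := hasFDerivAt_apply i q
  have hd : q 2 + α * q 3 ≠ 0 := by rw [h2, h3]; positivity
  have hD := (P 2).fun_add ((P 3).const_mul α)
  have hI := (hasDerivAt_inv hd).comp_hasFDerivAt q hD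
  have e0 := ((P 0).const_mul f₁).fun_sub (((P 0).const_mul p).fun_mul ((P 2).fun_add ((P 3).const_mul β)))
  have e1 := ((P 1).const_mul f₂).fun_sub (((P 1).const_mul p).fun_mul (P 3))
  have e2 := ((((P 0).const_mul c).fun_mul (P 2)).fun_mul hI).fun_sub ((P 2).const_mul b)
  have e3 := ((((((P 0).const_mul α).fun_mul (P 3)).fun_mul hI).fun_add (P 1)).const_mul c).fun_sub ((P 3).const_mul b)
  have E0 := HasFDerivAt.fderiv (f := fun v => G p c b f₁ f₂ α β v 0) e0
  have E1 := HasFDerivAt.fderiv (f := fun v => G p c b f₁ f₂ α β v 1) e1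
  have E2 := HasFDerivAt.fderiv (f := fun v => G p c b f₁ f₂ α β v 2) e2
  have E3 := HasFDerivAt.fderiv (f := fun v => G p c b f₁ f₂ α β v 3) e3
  have hp' := hp.ne'
  have hf' := hf₂.ne'
  have hα' := hα.ne'
  ext i j
  fin_cases i <;> simp only [jacobianMat, Matrix.of_apply, Fin.zero_eta, Fin.mk_one, Fin.reduceFinMk, E0, E1, E2, E3] <;>
  fin_cases j <;> simp [h0, h1, h2, h3, Pi.single_apply, hf] <;> field_simp <;> ring

lemma quad_root (b K : ℝ) (hb : 0 < b) (hK : 0 < K) (z : ℂ) (h : z * z + b * z + K = 0) :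
    z.re < 0 := by
  have hr := congrArg Complex.re h
  have hi := congrArg Complex.im h
  simp at hr hi
  by_contra hn
  push Not at hn
  have : z.im * (2 * z.re + b) = 0 := by linarith
  rcases mul_eq_zero.1 this with h0 | h0
  · rw [h0] at hr; nlinarith [mul_nonneg hb.le hn]
  · linarith

open Polynomial in
lemma charpoly_eq (A B D E m c b : ℝ) :
    (!![0, 0, A, -B; 0, 0, 0, -D; 0, 0, m, 0; c, c, E, -b] : Matrix (Fin 4) (Fin 4) ℝ).charpoly =
      (X - C 0) * ((X - C m) * (X ^ 2 + C b * X + C (c * (B + D)))) := by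
  rw [Matrix.charpoly, Matrix.det_succ_row_zero]
  simp [Fin.sum_univ_succ, Matrix.det_fin_three, Matrix.charmatrix_apply, Fin.succAbove, Matrix.diagonal_apply]
  ring

/-- If `0 < x₁ < αbf₂/(cp)`, then every complex root `λ` of the characteristic
polynomial of the Jacobian `J` of `G` at `q(x₁)` satisfies `λ = 0` or
`Re(λ) < 0`; moreover `0` is a root of multiplicity one, so the equilibrium
`q(x₁)` is marginally stable: all eigenvalues other than the single zero
eigenvalue lie in the open left half-plane. -/
theorem stmt10 (p c b f₁ f₂ α β : ℝ)
    (hp : 0 < p) (hc : 0 < c) (hb : 0 < b) (hf₁ : 0 < f₁) (hf₂ : 0 < f₂)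
    (hβ : 0 < β) (hβα : β < α) (hα : α < 1)
    (hf : f₁ = β * f₂)
    (x₁ : ℝ) (hx₁ : 0 < x₁) (hx₁' : x₁ < α * b * f₂ / (c * p)) :
    (∀ z : ℂ,
      ((Matrix.charpoly (jacobianMat (G p c b f₁ f₂ α β) (qTwo p c b f₂ x₁))).map
          (algebraMap ℝ ℂ)).IsRoot z →
        z = 0 ∨ z.re < 0) ∧
    (Matrix.charpoly (jacobianMat (G p c b f₁ f₂ α β) (qTwo p c b f₂ x₁))).rootMultiplicity 0
      = 1 := by
  have hα0 : 0 < α := hβ.trans hβα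
  have hcp : 0 < c * p := mul_pos hc hp
  have hx2 : 0 < b * f₂ / (c * p) - x₁ := by
    have : α * b * f₂ / (c * p) < b * f₂ / (c * p) := by
      apply div_lt_div_of_pos_right _ hcp
      nlinarith [mul_pos hb hf₂]
    linarith
  have hm : c * x₁ / (α * (f₂ / p)) - b < 0 := by
    rw [lt_div_iff₀ hcp] at hx₁'
    rw [sub_neg, div_lt_iff₀ (by positivity)]
    have : b * (α * (f₂ / p)) = α * b * f₂ / p := by ring
    rw [this, lt_div_iff₀ hp]
    linarith
  rw [jac_eq p c b f₁ f₂ α β x₁ hp hf₂ hα0 hf, charpoly_eq]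
  generalize c * x₁ / (α * (f₂ / p)) - b = m at *
  have hK : 0 < c * (p * β * x₁ + p * (b * f₂ / (c * p) - x₁)) := by positivity
  generalize c * (p * β * x₁ + p * (b * f₂ / (c * p) - x₁)) = K at *
  constructor
  · intro z hz
    simp [Polynomial.IsRoot] at hz
    rcases hz with hz | hz | hz
    · exact Or.inl hz
    · right
      rw [sub_eq_zero.1 hz]
      simpa using hm
    · right
      apply quad_root b K hb hK z
      rw [← hz]; ring
  · have hne : ((Polynomial.X - Polynomial.C m) *
        (Polynomial.X ^ 2 + Polynomial.C b * Polynomial.X + Polynomial.C K)).eval 0 ≠ 0 := by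
      simp [hm.ne, hK.ne']
    have hne' : ((Polynomial.X - Polynomial.C m) *
        (Polynomial.X ^ 2 + Polynomial.C b * Polynomial.X + Polynomial.C K)) ≠ 0 := by
      intro h; rw [h] at hne; simp at hne
    rw [Polynomial.rootMultiplicity_mul (mul_ne_zero (Polynomial.X_sub_C_ne_zero 0) hne'),
      Polynomial.rootMultiplicity_X_sub_C_self, Polynomial.rootMultiplicity_eq_zero hne]
end

section
/- Assume f₁ = β·Σ_{j=2}^n fⱼ. Then for every x₁ with 0 < x₁ < (b/c)N_r, the point q(x₁) is an equilibrium of H, i.e. H(q(x₁)) = 0. Thus one persistent node supported only by n−1 neutral nodes admits a one-parameter family of local-immunodeficiency equilibria. -/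
/-- The vector field of the viral evolution model on the star
cross-immunoreactivity network with one directed edge from node 1 (index `0`,
persistent) to each of the neutral nodes `2, …, n`. The state is
`v : Fin n ⊕ Fin n → ℝ`, where `v (Sum.inl i)` is the viral population `xᵢ₊₁`
and `v (Sum.inr i)` is the immune response `rᵢ₊₁`. -/
noncomputable def Hstar (n : ℕ) [NeZero n] (p c b α β : ℝ) (f : Fin n → ℝ)
    (v : Fin n ⊕ Fin n → ℝ) : Fin n ⊕ Fin n → ℝ := fun k =>
  let S : ℝ := ∑ j ∈ Finset.univ.erase (0 : Fin n), v (Sum.inr j)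
  match k with
  | Sum.inl i =>
      if i = 0 then f 0 * v (Sum.inl 0) - p * v (Sum.inl 0) * (v (Sum.inr 0) + β * S)
      else f i * v (Sum.inl i) - p * v (Sum.inl i) * v (Sum.inr i)
  | Sum.inr i =>
      if i = 0 then c * v (Sum.inl 0) * v (Sum.inr 0) / (v (Sum.inr 0) + α * S)
          - b * v (Sum.inr 0)
      else c * α * v (Sum.inl 0) * v (Sum.inr i) / (v (Sum.inr 0) + α * S)
          + c * v (Sum.inl i) - b * v (Sum.inr i)

/-- `N_r = Σ_{j=2}^n rⱼ* = Σ_{j=2}^n fⱼ/p`. -/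
noncomputable def Nr (n : ℕ) [NeZero n] (p : ℝ) (f : Fin n → ℝ) : ℝ :=
  ∑ j ∈ Finset.univ.erase (0 : Fin n), f j / p

/-- The one-parameter family of local-immunodeficiency points `q(x₁)`. -/
noncomputable def qStar (n : ℕ) [NeZero n] (p c b : ℝ) (f : Fin n → ℝ) (x₁ : ℝ) :
    Fin n ⊕ Fin n → ℝ := fun k =>
  match k with
  | Sum.inl i => if i = 0 then x₁ else b / c * (f i / p) - f i / p / Nr n p f * x₁
  | Sum.inr i => if i = 0 then 0 else f i / p

/-- Assume `f₁ = β·Σ_{j=2}^n fⱼ`. Then for every `0 < x₁ < (b/c)N_r`, the point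
`q(x₁)` is an equilibrium of `H`: one persistent node supported only by `n − 1`
neutral nodes admits a one-parameter family of local-immunodeficiency
equilibria. -/
theorem stmt11 (n : ℕ) [NeZero n] (hn : 2 ≤ n) (p c b α β : ℝ) (f : Fin n → ℝ)
    (hp : 0 < p) (hc : 0 < c) (hb : 0 < b) (hf : ∀ i, 0 < f i)
    (hβ : 0 < β) (hβα : β < α) (hα : α < 1)
    (hf₁ : f 0 = β * ∑ j ∈ Finset.univ.erase (0 : Fin n), f j) :
    ∀ x₁ : ℝ, 0 < x₁ → x₁ < b / c * Nr n p f →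
      Hstar n p c b α β f (qStar n p c b f x₁) = 0 := by
  intro x₁ hx hx2
  have hN : 0 < Nr n p f := by
    have h1 : 0 < b / c * Nr n p f := hx.trans hx2
    exact (pos_iff_pos_of_mul_pos h1).1 (div_pos hb hc)
  have hα0 : 0 < α := hβ.trans hβα
  have hS : ∑ j ∈ Finset.univ.erase (0 : Fin n), qStar n p c b f x₁ (Sum.inr j)
      = Nr n p f := by
    unfold Nr
    refine Finset.sum_congr rfl fun j hj => ?_
    simp [qStar, Finset.ne_of_mem_erase hj]
  have hf0 : f 0 = β * (p * Nr n p f) := by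
    rw [hf₁]
    unfold Nr
    rw [← Finset.sum_div]
    field_simp
  funext k
  rcases k with i | i
  · by_cases hi : i = 0
    · simp only [Hstar, hS, hi, if_true, Pi.zero_apply]
      simp only [qStar, if_true]
      rw [hf0]; ring
    · simp only [Hstar, hi, if_false, Pi.zero_apply]
      simp only [qStar, hi, if_false]
      field_simp
      ring
  · by_cases hi : i = 0
    · simp only [Hstar, hS, hi, if_true, Pi.zero_apply]
      simp [qStar]
    · simp only [Hstar, hS, hi, if_false, Pi.zero_apply]
      simp only [qStar, hi, if_false, if_true, zero_add]
      have := hN.ne'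
      field_simp
      ring
end

section
/- Suppose a point (x₁, …, x_n, r₁, …, r_n) satisfies H = 0 together with r₁ = 0, xᵢ > 0 for all 1 ≤ i ≤ n, and rᵢ > 0 for all 2 ≤ i ≤ n. Then necessarily f₁ = β·Σ_{j=2}^n fⱼ, rᵢ = fᵢ/p for i ≥ 2, xᵢ = (b/c)rᵢ − (rᵢ/N)x₁ for i ≥ 2 where N = Σ_{j=2}^n rⱼ, and the persistent population is bounded: x₁ < (b/(cp))·Σ_{j=2}^n fⱼ. In particular, without altruistic viruses the concentration of the persistent virus cannot exceed (b/(cp))·Σ_{j=2}^n fⱼ. -/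
/-- Any point with `H = 0`, `r₁ = 0`, all `xᵢ > 0` and `rᵢ > 0` for `i ≥ 2`
necessarily satisfies `f₁ = β·Σ_{j=2}^n fⱼ`, `rᵢ = fᵢ/p` for `i ≥ 2`,
`xᵢ = (b/c)rᵢ − (rᵢ/N)x₁` for `i ≥ 2` where `N = Σ_{j=2}^n rⱼ`, and the
persistent population is bounded: `x₁ < (b/(cp))·Σ_{j=2}^n fⱼ`. -/
theorem stmt12 (n : ℕ) [NeZero n] (hn : 2 ≤ n) (p c b α β : ℝ) (f : Fin n → ℝ)
    (hp : 0 < p) (hc : 0 < c) (hb : 0 < b) (hf : ∀ i, 0 < f i)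
    (hβ : 0 < β) (hβα : β < α) (hα : α < 1)
    (v : Fin n ⊕ Fin n → ℝ)
    (hH : Hstar n p c b α β f v = 0)
    (hr₁ : v (Sum.inr 0) = 0)
    (hx : ∀ i : Fin n, 0 < v (Sum.inl i))
    (hr : ∀ i : Fin n, i ≠ 0 → 0 < v (Sum.inr i)) :
    f 0 = β * ∑ j ∈ Finset.univ.erase (0 : Fin n), f j ∧
    (∀ i : Fin n, i ≠ 0 → v (Sum.inr i) = f i / p) ∧
    (∀ i : Fin n, i ≠ 0 →
      v (Sum.inl i) = b / c * v (Sum.inr i)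
        - v (Sum.inr i) / (∑ j ∈ Finset.univ.erase (0 : Fin n), v (Sum.inr j))
            * v (Sum.inl 0)) ∧
    v (Sum.inl 0) < b / (c * p) * ∑ j ∈ Finset.univ.erase (0 : Fin n), f j := by
  have hi1 : (⟨1, by omega⟩ : Fin n) ≠ 0 := by
    intro h
    have := congrArg Fin.val h
    simp at this
  have hα0 : 0 < α := hβ.trans hβα
  have hN : 0 < ∑ j ∈ Finset.univ.erase (0 : Fin n), v (Sum.inr j) :=
    Finset.sum_pos (fun j hj => hr j (Finset.ne_of_mem_erase hj))
      ⟨_, Finset.mem_erase.2 ⟨hi1, Finset.mem_univ _⟩⟩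
  have h2 : ∀ i : Fin n, i ≠ 0 → v (Sum.inr i) = f i / p := by
    intro i hi
    have h := congrFun hH (Sum.inl i)
    simp only [Hstar, if_neg hi, Pi.zero_apply] at h
    have h' : v (Sum.inl i) * (f i - p * v (Sum.inr i)) = 0 := by linarith
    rcases mul_eq_zero.1 h' with h' | h'
    · exact absurd h' (hx i).ne'
    · rw [eq_div_iff hp.ne']; linarith
  have hS : ∑ j ∈ Finset.univ.erase (0 : Fin n), v (Sum.inr j)
      = (∑ j ∈ Finset.univ.erase (0 : Fin n), f j) / p := by
    rw [Finset.sum_div]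
    exact Finset.sum_congr rfl (fun j hj => h2 j (Finset.ne_of_mem_erase hj))
  have h3 : ∀ i : Fin n, i ≠ 0 →
      v (Sum.inl i) = b / c * v (Sum.inr i)
        - v (Sum.inr i) / (∑ j ∈ Finset.univ.erase (0 : Fin n), v (Sum.inr j))
            * v (Sum.inl 0) := by
    intro i hi
    have h := congrFun hH (Sum.inr i)
    simp only [Hstar, if_neg hi, Pi.zero_apply, hr₁, zero_add] at h
    generalize (∑ j ∈ Finset.univ.erase (0 : Fin n), v (Sum.inr j)) = N at *
    have hN' := hN.ne'
    have hα' := hα0.ne'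
    have hc' := hc.ne'
    field_simp at h ⊢
    linarith
  refine ⟨?_, h2, h3, ?_⟩
  · have h := congrFun hH (Sum.inl 0)
    simp only [Hstar, if_true, Pi.zero_apply, hr₁, zero_add, hS] at h
    have h' : v (Sum.inl 0) *
        (f 0 - β * ∑ j ∈ Finset.univ.erase (0 : Fin n), f j) = 0 := by
      field_simp at h
      linarith
    rcases mul_eq_zero.1 h' with h' | h'
    · exact absurd h' (hx 0).ne'
    · linarith
  · have h := h3 _ hi1
    have hxp := hx ⟨1, by omega⟩
    have hrp := hr _ hi1
    rw [h] at hxp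
    have e : b / (c * p) * ∑ j ∈ Finset.univ.erase (0 : Fin n), f j
        = b / c * ∑ j ∈ Finset.univ.erase (0 : Fin n), v (Sum.inr j) := by
      rw [hS]; field_simp
    rw [e]
    generalize (∑ j ∈ Finset.univ.erase (0 : Fin n), v (Sum.inr j)) = N at *
    have e2 : b / c * v (Sum.inr ⟨1, by omega⟩) - v (Sum.inr ⟨1, by omega⟩) / N * v (Sum.inl 0)
        = v (Sum.inr ⟨1, by omega⟩) / N * (b / c * N - v (Sum.inl 0)) := by
      have hN' := hN.ne'
      field_simp
    rw [e2] at hxp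
    have := (mul_pos_iff_of_pos_left (div_pos hrp hN)).1 hxp
    linarith
end

section
/- Let J be the 2n×2n Jacobian matrix of H at the equilibrium q(x₁), and let w ∈ ℝ^{2n} be the vector whose x-part is (N_r, −r₂*, −r₃*, …, −r_n*) and whose r-part is 0. Then w ≠ 0 and J·w = 0; that is, w lies in the kernel of the Jacobian, and the direction of the one-parameter family of equilibria spans a zero eigendirection. -/
/-- The vector `w` whose `x`-part is `(N_r, −r₂*, …, −r_n*)` and whose `r`-part
is `0`. -/
noncomputable def wStar (n : ℕ) [NeZero n] (p : ℝ) (f : Fin n → ℝ) :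
    Fin n ⊕ Fin n → ℝ := fun k =>
  match k with
  | Sum.inl i => if i = 0 then Nr n p f else -(f i / p)
  | Sum.inr _ => 0

theorem mulVec_zero_aux {ι : Type*} [Fintype ι] [DecidableEq ι]
    (H : (ι → ℝ) → ι → ℝ) (y w : ι → ℝ) (h : ∀ (t : ℝ) k, H (y + t • w) k = 0) :
    (jacobianMat H y).mulVec w = 0 := by
  ext k
  have h1 : (jacobianMat H y).mulVec w k = fderiv ℝ (fun v => H v k) y w := by
    have h2 := LinearMap.pi_apply_eq_sum_univ
      (fderiv ℝ (fun v => H v k) y : (ι → ℝ) →ₗ[ℝ] ℝ) w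
    rw [ContinuousLinearMap.coe_coe] at h2
    rw [h2]
    simp only [Matrix.mulVec, dotProduct, jacobianMat, Matrix.of_apply, smul_eq_mul]
    refine Finset.sum_congr rfl fun j _ => ?_
    rw [mul_comm]
    congr 2
    ext i
    simp [Pi.single_apply, eq_comm]
  rw [h1]
  by_cases hd : DifferentiableAt ℝ (fun v => H v k) y
  · rw [← hd.lineDeriv_eq_fderiv]
    simp [lineDeriv, h]
  · simp [fderiv_zero_of_not_differentiableAt hd]

/-- The vector `w` is nonzero and lies in the kernel of the Jacobian `J` of `H`
at the equilibrium `q(x₁)`: `w ≠ 0` and `J·w = 0`, so the direction of the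
one-parameter family of equilibria spans a zero eigendirection. -/
theorem stmt13 (n : ℕ) [NeZero n] (hn : 2 ≤ n) (p c b α β : ℝ) (f : Fin n → ℝ)
    (hp : 0 < p) (hc : 0 < c) (hb : 0 < b) (hf : ∀ i, 0 < f i)
    (hβ : 0 < β) (hβα : β < α) (hα : α < 1)
    (hf₁ : f 0 = β * ∑ j ∈ Finset.univ.erase (0 : Fin n), f j)
    (x₁ : ℝ) (hx₁ : 0 < x₁) (hx₁' : x₁ < b / c * Nr n p f) :
    wStar n p f ≠ 0 ∧
    (jacobianMat (Hstar n p c b α β f) (qStar n p c b f x₁)).mulVec (wStar n p f)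
      = 0 := by
  have hN : 0 < Nr n p f := by
    have h : 0 < b / c := div_pos hb hc
    by_contra hcon
    have := mul_nonpos_of_nonneg_of_nonpos h.le (not_lt.mp hcon)
    linarith
  have hα0 : 0 < α := hβ.trans hβα
  refine ⟨fun h => ?_, mulVec_zero_aux _ _ _ fun t k => ?_⟩
  · have := congrFun h (Sum.inl 0)
    simp [wStar] at this
    exact hN.ne' this
  · have hS : ∑ j ∈ Finset.univ.erase (0 : Fin n),
        (qStar n p c b f x₁ + t • wStar n p f) (Sum.inr j) = Nr n p f := by
      unfold Nr
      refine Finset.sum_congr rfl fun j hj => ?_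
      simp [qStar, wStar, Finset.ne_of_mem_erase hj]
    have hpN : p * Nr n p f = ∑ j ∈ Finset.univ.erase (0 : Fin n), f j := by
      unfold Nr
      rw [Finset.mul_sum]
      exact Finset.sum_congr rfl fun j _ => by field_simp
    rw [← hpN] at hf₁
    have hN0 := hN.ne'
    unfold Hstar
    rw [hS]
    rcases k with i | i <;> by_cases hi : i = 0
    · subst hi
      simp [qStar, wStar, hf₁]
      ring
    · simp [qStar, wStar, hi]
      field_simp
      ring
    · subst hi
      simp [qStar, wStar]
    · simp [qStar, wStar, hi]
      field_simp
      ring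
end

section
/- For every x₁ with 0 < x₁ < (b/c)N_r, the 2n×2n Jacobian matrix J of H at the equilibrium q(x₁) is not invertible: det J = 0, so 0 is an eigenvalue of J. Consequently no equilibrium of this family is linearly (asymptotically) stable. -/
theorem Hstar_qStar (n : ℕ) [NeZero n] (hn : 2 ≤ n) (p c b α β : ℝ) (f : Fin n → ℝ)
    (hp : 0 < p) (hc : 0 < c) (hα : 0 < α) (hf : ∀ i, 0 < f i)
    (hf₁ : f 0 = β * ∑ j ∈ Finset.univ.erase (0 : Fin n), f j) (x : ℝ) (k : Fin n ⊕ Fin n) :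
    0 < Nr n p f ∧ Hstar n p c b α β f (qStar n p c b f x) k = 0 := by
  have hN : 0 < Nr n p f := by
    refine Finset.sum_pos (fun i _ => div_pos (hf i) hp) ⟨⟨1, by omega⟩, ?_⟩
    simp [Fin.ext_iff]
  refine ⟨hN, ?_⟩
  have hS : ∑ j ∈ Finset.univ.erase (0 : Fin n), qStar n p c b f x (Sum.inr j) = Nr n p f := by
    refine Finset.sum_congr rfl fun j hj => ?_
    simp [qStar, Finset.ne_of_mem_erase hj]
  have hN2 : f 0 = β * (p * Nr n p f) := by
    rw [hf₁, Nr, Finset.mul_sum _ _ p]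
    congr 1
    refine Finset.sum_congr rfl fun j _ => ?_
    field_simp
  rcases k with i | i
  · by_cases hi : i = 0
    · simp only [Hstar, hS, hi, if_true]
      simp only [qStar, if_true]
      rw [hN2]; ring
    · simp only [Hstar, hi, if_false]
      simp only [qStar, hi, if_false]
      field_simp
      ring
  · by_cases hi : i = 0
    · simp only [Hstar, hS, hi, if_true]
      simp [qStar]
    · simp only [Hstar, hS, hi, if_false]
      simp only [qStar, hi, if_false, if_true]
      have := hN.ne'
      field_simp
      ring

/-- For every `0 < x₁ < (b/c)N_r`, the `2n × 2n` Jacobian `J` of `H` at the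
equilibrium `q(x₁)` is not invertible: `det J = 0`, so `0` is an eigenvalue of
`J` (a root of its characteristic polynomial). Consequently no equilibrium of
this family is linearly (asymptotically) stable. -/
theorem stmt14 (n : ℕ) [NeZero n] (hn : 2 ≤ n) (p c b α β : ℝ) (f : Fin n → ℝ)
    (hp : 0 < p) (hc : 0 < c) (hb : 0 < b) (hf : ∀ i, 0 < f i)
    (hβ : 0 < β) (hβα : β < α) (hα : α < 1)
    (hf₁ : f 0 = β * ∑ j ∈ Finset.univ.erase (0 : Fin n), f j)
    (x₁ : ℝ) (hx₁ : 0 < x₁) (hx₁' : x₁ < b / c * Nr n p f) :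
    (jacobianMat (Hstar n p c b α β f) (qStar n p c b f x₁)).det = 0 ∧
    (Matrix.charpoly
        (jacobianMat (Hstar n p c b α β f) (qStar n p c b f x₁))).IsRoot 0 := by
  have hα0 : 0 < α := hβ.trans hβα
  set J := jacobianMat (Hstar n p c b α β f) (qStar n p c b f x₁) with hJ
  set w : Fin n ⊕ Fin n → ℝ := fun k => qStar n p c b f 1 k - qStar n p c b f 0 k with hw
  have hline : ∀ t : ℝ, qStar n p c b f x₁ + t • w = qStar n p c b f (x₁ + t) := by
    intro t
    funext k
    rcases k with i | i <;> by_cases hi : i = 0 <;> simp [hw, qStar, hi] <;> ring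
  have hdet : J.det = 0 := by
    rw [← Matrix.exists_mulVec_eq_zero_iff]
    refine ⟨w, fun h => ?_, ?_⟩
    · have := congrFun h (Sum.inl 0)
      simp [hw, qStar] at this
    · funext k
      have h1 : (J.mulVec w) k
          = fderiv ℝ (fun v => Hstar n p c b α β f v k) (qStar n p c b f x₁) w := by
        conv_rhs => rw [pi_eq_sum_univ' w]
        simp only [map_sum, map_smul, Matrix.mulVec, dotProduct, hJ, jacobianMat, Matrix.of_apply,
          smul_eq_mul]
        refine Finset.sum_congr rfl fun j _ => ?_
        rw [mul_comm]
      rw [h1]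
      by_cases hd : DifferentiableAt ℝ (fun v => Hstar n p c b α β f v k) (qStar n p c b f x₁)
      · rw [← hd.lineDeriv_eq_fderiv]
        simp only [lineDeriv, hline,
          (Hstar_qStar n hn p c b α β f hp hc hα0 hf hf₁ _ k).2]
        simp
      · rw [fderiv_zero_of_not_differentiableAt hd]; rfl
  refine ⟨hdet, ?_⟩
  rw [Polynomial.IsRoot, ← Polynomial.coeff_zero_eq_eval_zero]
  rw [Matrix.det_eq_sign_charpoly_coeff] at hdet
  simpa using hdet
end

section
/- If α·(b/c)·N_r < x₁ < (b/c)·N_r, then the Jacobian matrix J of H at q(x₁) has a strictly positive real eigenvalue (namely λ₁ = c·x₁/(α·N_r) − b > 0), so the equilibrium q(x₁) is linearly unstable; whereas if 0 < x₁ < α·(b/c)·N_r then λ₁ < 0. -/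
theorem jac_row_aux (n : ℕ) [NeZero n] (p c b α β : ℝ) (f : Fin n → ℝ) (x₁ : ℝ)
    (hN : α * Nr n p f ≠ 0) (j : Fin n ⊕ Fin n) :
    jacobianMat (Hstar n p c b α β f) (qStar n p c b f x₁) (Sum.inr 0) j =
      (c * x₁ / (α * Nr n p f) - b) * (Pi.single j (1 : ℝ) : Fin n ⊕ Fin n → ℝ) (Sum.inr 0) := by
  set q := qStar n p c b f x₁ with hq
  have hS : ∑ j ∈ Finset.univ.erase (0 : Fin n), q (Sum.inr j) = Nr n p f := by
    unfold Nr
    refine Finset.sum_congr rfl fun i hi => ?_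
    simp [hq, qStar, Finset.ne_of_mem_erase hi]
  have h0 : q (Sum.inr 0) = 0 := by simp [hq, qStar]
  have h1 : q (Sum.inl 0) = x₁ := by simp [hq, qStar]
  have hfun : (fun v => Hstar n p c b α β f v (Sum.inr 0)) = fun v => v (Sum.inr 0) *
      (c * v (Sum.inl 0) / (v (Sum.inr 0) +
        α * ∑ j ∈ Finset.univ.erase (0 : Fin n), v (Sum.inr j)) - b) := by
    funext v
    simp only [Hstar, if_true]
    ring
  have hG : DifferentiableAt ℝ (fun v : Fin n ⊕ Fin n → ℝ =>
      (c * v (Sum.inl 0) / (v (Sum.inr 0) +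
        α * ∑ j ∈ Finset.univ.erase (0 : Fin n), v (Sum.inr j)) - b)) q := by
    apply DifferentiableAt.sub_const
    simp only [div_eq_mul_inv]
    apply DifferentiableAt.fun_mul
    · fun_prop
    apply DifferentiableAt.fun_inv
    · fun_prop
    rw [hS, h0, zero_add]
    exact hN
  have hP : HasFDerivAt (fun v : Fin n ⊕ Fin n → ℝ => v (Sum.inr 0))
      (ContinuousLinearMap.proj (R := ℝ) (φ := fun _ : Fin n ⊕ Fin n => ℝ) (Sum.inr 0)) q :=
    hasFDerivAt_apply _ _
  have := (hP.fun_mul hG.hasFDerivAt).fderiv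
  simp only [jacobianMat, Matrix.of_apply, hfun]
  rw [this]
  simp [h0, h1, hS]

/-- If `α·(b/c)·N_r < x₁ < (b/c)·N_r`, then the Jacobian `J` of `H` at `q(x₁)`
has a strictly positive real eigenvalue, namely `λ₁ = c·x₁/(α·N_r) − b > 0`, so
the equilibrium `q(x₁)` is linearly unstable; whereas if
`0 < x₁ < α·(b/c)·N_r`, then `λ₁ < 0`. -/
theorem stmt16 (n : ℕ) [NeZero n] (hn : 2 ≤ n) (p c b α β : ℝ) (f : Fin n → ℝ)
    (hp : 0 < p) (hc : 0 < c) (hb : 0 < b) (hf : ∀ i, 0 < f i)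
    (hβ : 0 < β) (hβα : β < α) (hα : α < 1)
    (hf₁ : f 0 = β * ∑ j ∈ Finset.univ.erase (0 : Fin n), f j)
    (x₁ : ℝ) (hx₁ : 0 < x₁) (hx₁' : x₁ < b / c * Nr n p f) :
    (α * (b / c) * Nr n p f < x₁ →
      0 < c * x₁ / (α * Nr n p f) - b ∧
      (Matrix.charpoly
          (jacobianMat (Hstar n p c b α β f) (qStar n p c b f x₁))).IsRoot
        (c * x₁ / (α * Nr n p f) - b)) ∧
    (x₁ < α * (b / c) * Nr n p f → c * x₁ / (α * Nr n p f) - b < 0) := by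
  have hα0 : 0 < α := hβ.trans hβα
  have hN : 0 < Nr n p f := by
    have : 0 < b / c := by positivity
    by_contra h
    nlinarith
  have hαN : 0 < α * Nr n p f := by positivity
  have key : α * (b / c) * Nr n p f = b * (α * Nr n p f) / c := by ring
  rw [key]
  refine ⟨fun h => ⟨?_, ?_⟩, fun h => ?_⟩
  · rw [div_lt_iff₀ hc] at h
    rw [sub_pos, lt_div_iff₀ hαN]
    linarith
  · rw [Polynomial.IsRoot, Matrix.eval_charpoly]
    refine Matrix.det_eq_zero_of_row_eq_zero (Sum.inr 0) fun j => ?_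
    rw [Matrix.sub_apply, jac_row_aux n p c b α β f x₁ hαN.ne' j]
    by_cases hj : j = Sum.inr 0
    · subst hj; simp
    · simp [Matrix.scalar_apply, Matrix.diagonal_apply, Pi.single_apply, Ne.symm hj]
  · rw [lt_div_iff₀ hc] at h
    rw [sub_neg, div_lt_iff₀ hαN]
    linarith
end
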